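/- Let μ be a probability measure on ℝ (the law of the true confidence X) having density f with respect to Lebesgue measure, and let κ be a Markov kernel from ℝ to ℝ (the conditional law of the predicted confidence Y given X = ξ); let the joint law of (X, Y) be the composition-product μ ⊗ κ. Let ε : ℝ → ℝ be measurable with 0 ≤ ε(δ') ≤ 1 for all δ', and assume that for every ξ ∈ ℝ and every δ' > 0, κ(ξ)({y : |y − ξ| ≥ δ'}) ≤ ε(δ'). Fix α ∈ ℝ, β > 0 and δ > 0, and define the error event A = {(x, y) : (y ≥ α ∧ x ≥ α ∧ β·|y − x| > δ) ∨ (y ≥ α ∧ x < α) ∨ (y < α ∧ x ≥ α)}, i.e., the event that the thresholded weighted confidences β[Y]_α and β[X]_α differ by more than δ. Then ℙ(A) ≤ ε(δ/β) + (1 − ε(δ/β)) · ∫_ℝ ε(|α − ξ|) f(ξ) dξ. -/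

import Mathlib

open MeasureTheory ProbabilityTheory

/-- Theorem 1 (error analysis for a soft atomic query). -/
theorem soft_atomic_query_error_bound
    (μ : Measure ℝ) [IsProbabilityMeasure μ] (f : ℝ → ℝ)
    (hfm : Measurable f) (hf0 : ∀ x, 0 ≤ f x)
    (hμ : μ = volume.withDensity (fun ξ => ENNReal.ofReal (f ξ)))
    (κ : Kernel ℝ ℝ) [IsMarkovKernel κ]
    (ε : ℝ → ℝ) (hεm : Measurable ε) (hε0 : ∀ x, 0 ≤ ε x) (hε1 : ∀ x, ε x ≤ 1)
    (hκ : ∀ ξ : ℝ, ∀ δ' > 0, κ ξ {y | |y - ξ| ≥ δ'} ≤ ENNReal.ofReal (ε δ'))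
    (α β δ : ℝ) (hβ : 0 < β) (hδ : 0 < δ) :
    (μ.compProd κ) {p : ℝ × ℝ |
        (p.2 ≥ α ∧ p.1 ≥ α ∧ β * |p.2 - p.1| > δ) ∨
        (p.2 ≥ α ∧ p.1 < α) ∨ (p.2 < α ∧ p.1 ≥ α)} ≤
      ENNReal.ofReal (ε (δ / β) + (1 - ε (δ / β)) * ∫ ξ : ℝ, ε |α - ξ| * f ξ) := by
  have hA : MeasurableSet {p : ℝ × ℝ |
        (p.2 ≥ α ∧ p.1 ≥ α ∧ β * |p.2 - p.1| > δ) ∨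
        (p.2 ≥ α ∧ p.1 < α) ∨ (p.2 < α ∧ p.1 ≥ α)} := by
    have h1 : MeasurableSet {p : ℝ × ℝ | p.2 ≥ α} := measurableSet_le (by fun_prop) (by fun_prop)
    have h2 : MeasurableSet {p : ℝ × ℝ | p.1 ≥ α} := measurableSet_le (by fun_prop) (by fun_prop)
    have h3 : MeasurableSet {p : ℝ × ℝ | β * |p.2 - p.1| > δ} :=
      measurableSet_lt (by fun_prop) (by fun_prop)
    have h4 : MeasurableSet {p : ℝ × ℝ | p.1 < α} := measurableSet_lt (by fun_prop) (by fun_prop)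
    have h5 : MeasurableSet {p : ℝ × ℝ | p.2 < α} := measurableSet_lt (by fun_prop) (by fun_prop)
    exact (h1.inter (h2.inter h3)).union ((h1.inter h4).union (h5.inter h2))
  have hgm : Measurable (fun ξ : ℝ => ε |α - ξ|) := hεm.comp (by fun_prop)
  have hint : Integrable (fun ξ : ℝ => ε |α - ξ|) μ := by
    refine Integrable.of_bound hgm.aestronglyMeasurable 1 (Filter.Eventually.of_forall fun ξ => ?_)
    rw [Real.norm_eq_abs, abs_of_nonneg (hε0 _)]
    exact hε1 _
  have hI : ∫ ξ : ℝ, ε |α - ξ| * f ξ = ∫ ξ, ε |α - ξ| ∂μ := by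
    rw [hμ, integral_withDensity_eq_integral_toReal_smul (by fun_prop)
      (Filter.Eventually.of_forall fun ξ => ENNReal.ofReal_lt_top)]
    refine integral_congr_ae (Filter.Eventually.of_forall fun ξ => ?_)
    simp [ENNReal.toReal_ofReal (hf0 ξ), mul_comm]
  have hR : ε (δ / β) + (1 - ε (δ / β)) * ∫ ξ : ℝ, ε |α - ξ| * f ξ
      = ∫ ξ, (ε (δ / β) + (1 - ε (δ / β)) * ε |α - ξ|) ∂μ := by
    rw [hI, integral_add (integrable_const _) (hint.const_mul _), integral_const_mul]
    simp
  have hint2 : Integrable (fun ξ : ℝ => ε (δ / β) + (1 - ε (δ / β)) * ε |α - ξ|) μ :=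
    (integrable_const _).add (hint.const_mul _)
  rw [hR, ofReal_integral_eq_lintegral_ofReal hint2
    (Filter.Eventually.of_forall fun ξ => add_nonneg (hε0 _)
      (mul_nonneg (sub_nonneg.2 (hε1 _)) (hε0 _))), Measure.compProd_apply hA]
  have hne : ∀ᵐ ξ ∂μ, ξ ≠ α := by
    have hac : μ ≪ volume := hμ ▸ withDensity_absolutelyContinuous _ _
    exact hac.ae_le (Measure.ae_ne volume α)
  refine lintegral_mono_ae ?_
  filter_upwards [hne] with ξ hξ
  have e1 := hε0 (δ / β)
  have e1' := hε1 (δ / β)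
  have e2 := hε0 |α - ξ|
  have e2' := hε1 |α - ξ|
  have hpos : 0 < |α - ξ| := abs_pos.2 (sub_ne_zero.2 hξ.symm)
  have hdb : 0 < δ / β := div_pos hδ hβ
  rcases le_total (δ / β) |α - ξ| with h | h
  · refine (measure_mono ?_).trans ((hκ ξ _ hdb).trans (ENNReal.ofReal_le_ofReal (by nlinarith)))
    rintro y (⟨-, -, h3⟩ | ⟨h1, h2⟩ | ⟨h1, h2⟩)
    · exact ((div_lt_iff₀' hβ).2 h3).le
    · refine h.trans ?_
      simp only at h1 h2
      rw [abs_of_pos (by linarith), abs_of_nonneg (by linarith)]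
      linarith
    · refine h.trans ?_
      simp only at h1 h2
      rw [abs_of_nonpos (by linarith), abs_of_nonpos (by linarith)]
      linarith
  · refine (measure_mono ?_).trans ((hκ ξ _ hpos).trans (ENNReal.ofReal_le_ofReal (by nlinarith)))
    rintro y (⟨-, -, h3⟩ | ⟨h1, h2⟩ | ⟨h1, h2⟩)
    · exact h.trans ((div_lt_iff₀' hβ).2 h3).le
    · simp only [Set.mem_setOf_eq] at h1 h2 ⊢
      rw [abs_of_pos (a := α - ξ) (by linarith), abs_of_nonneg (by linarith)]
      linarith
    · simp only [Set.mem_setOf_eq] at h1 h2 ⊢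
      rw [abs_of_nonpos (a := α - ξ) (by linarith), abs_of_nonpos (by linarith)]
      linarith
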